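/- arXiv:1905.02175 — 6 statements merged into one kernel-verified Lean document; each statement's English description precedes it below -/
import Mathlib

section
/- Let d ≥ 1, C > 0 and k > 0 with C·k/d > 1. For every σ ∈ ℝ^d with σ_i > 1/C for all i and Σᵢ σ_i = k, one has Σᵢ (1 + 1/(C·σ_i − 1))² ≥ d·(C·k/(C·k − d))², with equality if and only if σ_i = k/d for all i. Equivalently, among diagonal positive definite matrices Σ* with tr(Σ*) = k and C·Σ* − I positive definite, the quantity tr[(I + (C·Σ* − I)^{-1})²] is uniquely minimized at Σ* = (k/d)·I. -/
open Matrix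

/-- **Theorem 1, second claim.** For `C, k > 0` with `C·k/d > 1` and `σ ∈ ℝ^d` with
`σ i > 1/C` and `∑ i, σ i = k`, one has
`∑ i, (1 + 1/(C·σ i − 1))² ≥ d·(C·k/(C·k − d))²`, with equality iff `σ i = k/d` for all `i`;
i.e. the adversarial loss gap `tr[(I + (C·Σ* − I)⁻¹)²] − d` over diagonal positive definite
`Σ*` with `tr(Σ*) = k` and `C·Σ* − I ≻ 0` is uniquely minimized at `Σ* = (k/d)·I`. -/
theorem adversarial_gap_minimized_by_isotropic
    {d : ℕ} (hd : 1 ≤ d) (C k : ℝ) (hC : 0 < C) (hk : 0 < k)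
    (hCk : 1 < C * k / d)
    (σ : Fin d → ℝ) (hσ : ∀ i, 1 / C < σ i) (hsum : ∑ i, σ i = k) :
    (d * (C * k / (C * k - d)) ^ 2 ≤ ∑ i, (1 + 1 / (C * σ i - 1)) ^ 2) ∧
    ((∑ i, (1 + 1 / (C * σ i - 1)) ^ 2 = d * (C * k / (C * k - d)) ^ 2) ↔
      ∀ i, σ i = k / d) := by
  have hd0 : (0 : ℝ) < d := by exact_mod_cast hd
  have hx : ∀ i, 0 < C * σ i - 1 := by
    intro i
    have h := (div_lt_iff₀ hC).1 (hσ i)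
    linarith
  obtain ⟨a, ha⟩ : ∃ a, a = C * k / d - 1 := ⟨_, rfl⟩
  have ha0 : 0 < a := by linarith
  have hdk : C * k = d * (a + 1) := by rw [ha]; field_simp; ring
  have hconst : C * k / (C * k - d) = 1 + 1 / a := by
    have h1 : C * k - d = d * a := by rw [hdk]; ring
    rw [h1, hdk]; field_simp
  obtain ⟨R, hR⟩ : ∃ R : Fin d → ℝ, R = fun i => (1 / (C * σ i - 1) - 1 / a) ^ 2 +
      2 * (1 + 1 / a) * (C * σ i - 1 - a) ^ 2 / (a ^ 2 * (C * σ i - 1)) := ⟨_, rfl⟩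
  have hRn : ∀ i, 0 ≤ R i := by
    intro i
    have := hx i
    simp only [hR]
    positivity
  have hlin : ∑ i, (C * σ i - 1 - a) = 0 := by
    simp only [Finset.sum_sub_distrib, ← Finset.mul_sum, hsum]
    simp
    linarith
  have hf : ∀ i, (1 + 1 / (C * σ i - 1)) ^ 2 =
      (1 + 1 / a) ^ 2 + (-(2 * (1 + 1 / a) / a ^ 2)) * (C * σ i - 1 - a) + R i := by
    intro i
    have := hx i
    simp only [hR]
    generalize C * σ i - 1 = x at *
    field_simp
    ring
  have hS : ∑ i, (1 + 1 / (C * σ i - 1)) ^ 2 = d * (1 + 1 / a) ^ 2 + ∑ i, R i := by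
    simp_rw [hf]
    rw [Finset.sum_add_distrib, Finset.sum_add_distrib, ← Finset.mul_sum, hlin]
    simp
  have hRz : ∀ i, R i = 0 ↔ σ i = k / d := by
    intro i
    have hxi := hx i
    have hiff : σ i = k / d ↔ C * σ i - 1 - a = 0 := by
      rw [eq_div_iff hd0.ne']
      have h2 : C * (σ i * d - k) = d * (C * σ i - 1 - a) := by linarith
      constructor
      · intro h
        rw [h, sub_self, mul_zero] at h2
        exact (mul_eq_zero.1 h2.symm).resolve_left hd0.ne'
      · intro h
        rw [h, mul_zero] at h2
        have := (mul_eq_zero.1 h2).resolve_left hC.ne'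
        linarith
    rw [hiff]
    constructor
    · intro h
      by_contra hne
      have : 0 < R i := by
        simp only [hR]
        positivity
      linarith
    · intro h
      have h3 : C * σ i - 1 = a := by linarith
      simp [hR, h3]
  rw [hconst, hS]
  refine ⟨by linarith [Finset.sum_nonneg fun i (_ : i ∈ Finset.univ) => hRn i], ?_⟩
  rw [add_eq_left, Finset.sum_eq_zero_iff_of_nonneg fun i _ => hRn i]
  simp [hRz]
end

section
/- Let Σ and Σ* be d×d real diagonal positive definite matrices and let ε > 0. Define F(M) = tr(M·Σ^{-1}·Σ*) + (1/2)·tr(M·Σ^{-1}·M·Σ*) for diagonal matrices M, and let K = { M : M diagonal, tr(Σ*·M²) = ε² }. Then F attains a maximum on K, and every maximizer M of F on K is of the form M = (λ·Σ − I)^{-1} for some λ ∈ ℝ such that λ·Σ − I is invertible. -/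
open Matrix

lemma oao_exists {d : ℕ} (hd : 1 ≤ d) (s t : Fin d → ℝ) (ht : ∀ i, 0 < t i) (ε : ℝ) (hε : 0 < ε) :
    ∃ m : Fin d → ℝ, (∑ i, t i * m i ^ 2 = ε ^ 2) ∧ ∀ n : Fin d → ℝ, ∑ i, t i * n i ^ 2 = ε ^ 2 →
      ∑ i, t i / s i * (n i + n i ^ 2 / 2) ≤ ∑ i, t i / s i * (m i + m i ^ 2 / 2) := by
  have hne : (Finset.univ : Finset (Fin d)).Nonempty := ⟨⟨0, hd⟩, Finset.mem_univ _⟩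
  have hT : 0 < ∑ i, t i := Finset.sum_pos (fun i _ => ht i) hne
  have hcl : IsClosed {m : Fin d → ℝ | ∑ i, t i * m i ^ 2 = ε ^ 2} :=
    isClosed_eq (by fun_prop) (by fun_prop)
  have hsub : {m : Fin d → ℝ | ∑ i, t i * m i ^ 2 = ε ^ 2} ⊆
      Set.Icc (fun i => -(ε ^ 2 / t i + 1)) (fun i => ε ^ 2 / t i + 1) := by
    intro m hm
    have key : ∀ i, m i ^ 2 ≤ ε ^ 2 / t i := by
      intro i
      rw [le_div_iff₀ (ht i), mul_comm, ← (show _ = _ from hm)]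
      exact Finset.single_le_sum (f := fun i => t i * m i ^ 2)
        (fun j _ => mul_nonneg (ht j).le (sq_nonneg _)) (Finset.mem_univ i)
    constructor
    · intro i
      have := key i
      show -(ε ^ 2 / t i + 1) ≤ m i
      nlinarith [sq_nonneg (m i + 1), sq_nonneg (m i)]
    · intro i
      have := key i
      show m i ≤ ε ^ 2 / t i + 1
      nlinarith [sq_nonneg (m i - 1), sq_nonneg (m i)]
  have hcomp := isCompact_Icc.of_isClosed_subset hcl hsub
  have hnon : {m : Fin d → ℝ | ∑ i, t i * m i ^ 2 = ε ^ 2}.Nonempty := by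
    refine ⟨fun _ => ε / √(∑ i, t i), ?_⟩
    show ∑ i, t i * (ε / √(∑ i, t i)) ^ 2 = ε ^ 2
    rw [← Finset.sum_mul, div_pow, Real.sq_sqrt hT.le]
    field_simp
  obtain ⟨m, hm, hmax⟩ := hcomp.exists_isMaxOn hnon
    (f := fun n => ∑ i, t i / s i * (n i + n i ^ 2 / 2)) (by fun_prop)
  exact ⟨m, hm, fun n hn => hmax hn⟩

lemma oao_crit {d : ℕ} (s t : Fin d → ℝ) (hs : ∀ i, 0 < s i) (ht : ∀ i, 0 < t i)
    (ε : ℝ) (hε : 0 < ε)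
    (m : Fin d → ℝ) (hm : ∑ i, t i * m i ^ 2 = ε ^ 2)
    (hmax : ∀ n : Fin d → ℝ, ∑ i, t i * n i ^ 2 = ε ^ 2 →
      ∑ i, t i / s i * (n i + n i ^ 2 / 2) ≤ ∑ i, t i / s i * (m i + m i ^ 2 / 2)) :
    ∃ lam : ℝ, ∀ i, m i * (lam * s i - 1) = 1 := by
  have hp : ∀ i, HasStrictFDerivAt (fun n : Fin d → ℝ => n i)
      (ContinuousLinearMap.proj (R := ℝ) (φ := fun _ : Fin d => ℝ) i) m :=
    fun i => (ContinuousLinearMap.proj (R := ℝ) (φ := fun _ : Fin d => ℝ) i).hasStrictFDerivAt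
  have hf : HasStrictFDerivAt (fun n : Fin d → ℝ => ∑ i, t i * n i ^ 2) _ m :=
    HasStrictFDerivAt.fun_sum (u := Finset.univ) fun i _ => ((hp i).pow 2).const_mul (t i)
  have hg : HasStrictFDerivAt (fun n : Fin d → ℝ => ∑ i, t i / s i * (n i + n i ^ 2 * (1 / 2))) _ m :=
    HasStrictFDerivAt.fun_sum (u := Finset.univ) fun i _ =>
      ((hp i).add (((hp i).pow 2).mul_const (1 / 2))).const_mul (t i / s i)
  have hext : IsLocalExtrOn (fun n : Fin d → ℝ => ∑ i, t i / s i * (n i + n i ^ 2 * (1 / 2)))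
      {n | (fun n : Fin d → ℝ => ∑ i, t i * n i ^ 2) n = (fun n : Fin d → ℝ => ∑ i, t i * n i ^ 2) m} m := by
    right
    apply IsMaxOn.localize
    intro n hn
    have := hmax n (hn.trans hm)
    simpa [div_eq_mul_inv] using this
  obtain ⟨a, b, hab, h⟩ := hext.exists_multipliers_of_hasStrictFDerivAt_1d hf hg
  have hi : ∀ i, a * (t i * (2 * m i)) + b * (t i / s i * (1 + m i)) = 0 := by
    intro i
    have := congrArg (fun L => L (Pi.single i 1)) h
    simp [Pi.single_apply, Finset.sum_add_distrib] at this
    linarith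
  have hb : b ≠ 0 := by
    rintro rfl
    have ha : a ≠ 0 := by
      rintro rfl
      exact hab rfl
    have h0 : ∀ i, m i = 0 := by
      intro i
      have := hi i
      simpa [ha, (ht i).ne'] using this
    simp [h0] at hm
    exact (pow_pos hε 2).ne hm
  refine ⟨-2 * a / b, fun i => ?_⟩
  have h1 := hi i
  have := (hs i).ne'
  have h2 := (ht i).ne'
  field_simp at h1 ⊢
  rw [mul_zero] at h1
  have h3 := (mul_eq_zero.1 h1).resolve_left h2
  linarith

/-- **Optimal adversarial linear operator.** For diagonal positive definite `Σ, Σ*` and `ε > 0`,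
the function `F(M) = tr(M Σ⁻¹ Σ*) + (1/2)·tr(M Σ⁻¹ M Σ*)` attains a maximum over the set
`K = {M diagonal : tr(Σ*·M²) = ε²}`, and every maximizer has the form `M = (λΣ − I)⁻¹`
for some `λ` making `λΣ − I` invertible. -/
theorem optimal_adversarial_operator
    {d : ℕ} (hd : 1 ≤ d)
    (S Sstar : Matrix (Fin d) (Fin d) ℝ)
    (hSdiag : S.IsDiag) (hSpd : S.PosDef)
    (hSstardiag : Sstar.IsDiag) (hSstarpd : Sstar.PosDef)
    (ε : ℝ) (hε : 0 < ε)
    (F : Matrix (Fin d) (Fin d) ℝ → ℝ)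
    (hF : ∀ M, F M = Matrix.trace (M * S⁻¹ * Sstar)
            + (1 / 2) * Matrix.trace (M * S⁻¹ * M * Sstar))
    (K : Set (Matrix (Fin d) (Fin d) ℝ))
    (hK : K = {M | M.IsDiag ∧ Matrix.trace (Sstar * M ^ 2) = ε ^ 2}) :
    (∃ M ∈ K, ∀ N ∈ K, F N ≤ F M) ∧
    (∀ M ∈ K, (∀ N ∈ K, F N ≤ F M) →
      ∃ lam : ℝ, IsUnit (lam • S - 1) ∧ M = (lam • S - 1)⁻¹) := by
  obtain ⟨s, rfl⟩ : ∃ s, S = diagonal s := ⟨_, hSdiag.diagonal_diag.symm⟩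
  obtain ⟨t, rfl⟩ : ∃ t, Sstar = diagonal t := ⟨_, hSstardiag.diagonal_diag.symm⟩
  have hs : ∀ i, 0 < s i := Matrix.posDef_diagonal_iff.1 hSpd
  have ht : ∀ i, 0 < t i := Matrix.posDef_diagonal_iff.1 hSstarpd
  have hinv : (diagonal s)⁻¹ = diagonal (fun i => (s i)⁻¹) := by
    apply Matrix.inv_eq_right_inv
    rw [diagonal_mul_diagonal, ← diagonal_one]
    congr 1
    ext i
    exact mul_inv_cancel₀ (hs i).ne'
  have hFd : ∀ m, F (diagonal m) = ∑ i, t i / s i * (m i + m i ^ 2 / 2) := by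
    intro m
    rw [hF, hinv]
    simp only [diagonal_mul_diagonal, trace_diagonal]
    rw [Finset.mul_sum, ← Finset.sum_add_distrib]
    refine Finset.sum_congr rfl fun i _ => ?_
    ring
  have hKd : ∀ m, diagonal m ∈ K ↔ ∑ i, t i * m i ^ 2 = ε ^ 2 := by
    intro m
    rw [hK]
    simp [diagonal_pow, diagonal_mul_diagonal, trace_diagonal]
  have hKdiag : ∀ M ∈ K, ∃ m, M = diagonal m := by
    intro M hM
    rw [hK] at hM
    exact ⟨_, hM.1.diagonal_diag.symm⟩
  constructor
  · obtain ⟨m, hm, hmax⟩ := oao_exists hd s t ht ε hε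
    refine ⟨diagonal m, (hKd m).2 hm, fun N hN => ?_⟩
    obtain ⟨n, rfl⟩ := hKdiag N hN
    rw [hFd, hFd]
    exact hmax n ((hKd n).1 hN)
  · intro M hM hmax
    obtain ⟨m, rfl⟩ := hKdiag M hM
    obtain ⟨lam, hl⟩ := oao_crit s t hs ht ε hε m ((hKd m).1 hM) (fun n hn => by
      have := hmax _ ((hKd n).2 hn)
      rwa [hFd, hFd] at this)
    have hmul : diagonal m * (lam • diagonal s - 1) = 1 := by
      rw [← diagonal_one, ← diagonal_smul, diagonal_sub, diagonal_mul_diagonal]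
      congr 1
      ext i
      simpa using hl i
    exact ⟨lam, IsUnit.of_mul_eq_one_right _ hmul, (Matrix.inv_eq_left_inv hmul).symm⟩
end

section
/- Let A be a d×d real diagonal positive definite matrix and x ∈ ℝ^d. For every pair (T, m) with T a d×d diagonal positive definite matrix and m ∈ ℝ^d, the Lebesgue integral ∫_{ℝ^d} exp(−(1/2)·zᵀ A T z + mᵀ A z) dz is finite, and the function f(T, m) = (1/2)·xᵀ A T x − mᵀ A x + log ∫_{ℝ^d} exp(−(1/2)·zᵀ A T z + mᵀ A z) dz is convex on the convex set { (T, m) : T diagonal positive definite, m ∈ ℝ^d }. -/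
open MeasureTheory Matrix

lemma quad_eq_aux {d : ℕ} {A T : Matrix (Fin d) (Fin d) ℝ} (hA : A.IsDiag) (hT : T.IsDiag)
    (z : Fin d → ℝ) : z ⬝ᵥ (A * T).mulVec z = ∑ i, (A i i * T i i) * z i ^ 2 := by
  rw [← hA.diagonal_diag, ← hT.diagonal_diag, diagonal_mul_diagonal]
  simp only [dotProduct, mulVec_diagonal, diag_apply, diagonal_apply_eq]
  exact Finset.sum_congr rfl fun i _ => by ring

lemma lin_eq_aux {d : ℕ} {A : Matrix (Fin d) (Fin d) ℝ} (hA : A.IsDiag)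
    (m z : Fin d → ℝ) : m ⬝ᵥ A.mulVec z = ∑ i, (A i i * m i) * z i := by
  rw [← hA.diagonal_diag]
  simp only [dotProduct, mulVec_diagonal, diag_apply, diagonal_apply_eq]
  exact Finset.sum_congr rfl fun i _ => by ring

lemma integrable_aux {d : ℕ} {A T : Matrix (Fin d) (Fin d) ℝ} (hA : A.IsDiag) (hT : T.IsDiag)
    (hAp : A.PosDef) (hTp : T.PosDef) (m : Fin d → ℝ) :
    Integrable (fun z : Fin d → ℝ =>
        Real.exp (-(1 / 2) * (z ⬝ᵥ (A * T).mulVec z) + m ⬝ᵥ A.mulVec z)) := by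
  have h := (GaussianFourier.integrable_cexp_neg_sum_mul_add
    (b := fun i => (((1 / 2) * (A i i * T i i) : ℝ) : ℂ)) (fun i => by
      rw [Complex.ofReal_re]
      have h1 : 0 < A i i := hAp.diag_pos
      have h2 : 0 < T i i := hTp.diag_pos
      positivity) (fun i => ((A i i * m i : ℝ) : ℂ))).norm
  refine h.congr (Filter.Eventually.of_forall fun z => ?_)
  simp only [Complex.norm_exp]
  rw [quad_eq_aux hA hT, lin_eq_aux hA]
  congr 1
  rw [Finset.mul_sum, ← Complex.ofReal_re (∑ i, _ + ∑ i, _)]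
  congr 1
  push_cast
  rw [← Finset.sum_neg_distrib]
  congr 1
  exact Finset.sum_congr rfl fun i _ => by ring

lemma log_integral_aux {d : ℕ} {u v : (Fin d → ℝ) → ℝ} {a b : ℝ} (ha : 0 < a) (hb : 0 < b)
    (hab : a + b = 1) (hu : Integrable fun z => Real.exp (u z))
    (hv : Integrable fun z => Real.exp (v z))
    (hw : Integrable fun z => Real.exp (a * u z + b * v z)) :
    Real.log (∫ z, Real.exp (a * u z + b * v z)) ≤
      a * Real.log (∫ z, Real.exp (u z)) + b * Real.log (∫ z, Real.exp (v z)) := by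
  have hU := integral_exp_pos hu
  have hV := integral_exp_pos hv
  have hW := integral_exp_pos hw
  set U := ∫ z, Real.exp (u z) with hUd
  set V := ∫ z, Real.exp (v z) with hVd
  rw [Real.log_le_iff_le_exp hW]
  set L := a * Real.log U + b * Real.log V with hL
  have key : ∀ z, Real.exp (a * u z + b * v z) ≤
      Real.exp L * (a / U * Real.exp (u z) + b / V * Real.exp (v z)) := by
    intro z
    have := convexOn_exp.2 (Set.mem_univ (u z - Real.log U)) (Set.mem_univ (v z - Real.log V))
      ha.le hb.le hab
    simp only [smul_eq_mul, Real.exp_sub, Real.exp_log hU, Real.exp_log hV] at this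
    calc _ = Real.exp L * Real.exp (a * (u z - Real.log U) + b * (v z - Real.log V)) := by
          rw [← Real.exp_add]; congr 1; rw [hL]; ring
      _ ≤ _ := by
          refine mul_le_mul_of_nonneg_left (this.trans_eq ?_) (Real.exp_pos _).le
          ring
  have hi1 := hu.const_mul (a / U)
  have hi2 := hv.const_mul (b / V)
  refine (integral_mono hw ((hi1.add hi2).const_mul (Real.exp L)) key).trans_eq ?_
  simp only [Pi.add_apply]
  rw [integral_const_mul, integral_add hi1 hi2, integral_const_mul, integral_const_mul,
    ← hUd, ← hVd, div_mul_cancel₀ _ hU.ne', div_mul_cancel₀ _ hV.ne', hab, mul_one]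

/-- **Convexity of the outer minimization (natural parameterization).** For a diagonal positive
definite matrix `A` and `x ∈ ℝ^d`: for every diagonal positive definite `T` and `m ∈ ℝ^d`
the integral `∫ exp(−(1/2) zᵀ A T z + mᵀ A z) dz` is finite, and the Gaussian robust negative
log-likelihood `f(T, m) = (1/2)·xᵀ A T x − mᵀ A x + log ∫ exp(−(1/2) zᵀ A T z + mᵀ A z) dz`
is convex on the convex set of pairs `(T, m)` with `T` diagonal positive definite. -/
theorem robust_nll_convex
    {d : ℕ} (hd : 1 ≤ d)
    (A : Matrix (Fin d) (Fin d) ℝ) (hAdiag : A.IsDiag) (hApd : A.PosDef)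
    (x : Fin d → ℝ)
    (f : Matrix (Fin d) (Fin d) ℝ × (Fin d → ℝ) → ℝ)
    (hf : ∀ T m, f (T, m) =
        (1 / 2) * (x ⬝ᵥ (A * T).mulVec x) - m ⬝ᵥ A.mulVec x +
        Real.log (∫ z : Fin d → ℝ,
          Real.exp (-(1 / 2) * (z ⬝ᵥ (A * T).mulVec z) + m ⬝ᵥ A.mulVec z))) :
    (∀ (T : Matrix (Fin d) (Fin d) ℝ) (m : Fin d → ℝ), T.IsDiag → T.PosDef →
      Integrable (fun z : Fin d → ℝ =>
        Real.exp (-(1 / 2) * (z ⬝ᵥ (A * T).mulVec z) + m ⬝ᵥ A.mulVec z))) ∧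
    ConvexOn ℝ {p : Matrix (Fin d) (Fin d) ℝ × (Fin d → ℝ) | p.1.IsDiag ∧ p.1.PosDef} f := by
  refine ⟨fun T m hT hTp => integrable_aux hAdiag hT hApd hTp m, ?_⟩
  have hmem : ∀ (T S : Matrix (Fin d) (Fin d) ℝ) (a b : ℝ), 0 < a → 0 < b →
      T.IsDiag → T.PosDef → S.IsDiag → S.PosDef →
      (a • T + b • S).IsDiag ∧ (a • T + b • S).PosDef := fun T S a b ha hb h1 h2 h3 h4 =>
    ⟨(h1.smul a).add (h3.smul b), (h2.smul ha).add (h4.smul hb)⟩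
  rw [convexOn_iff_forall_pos]
  refine ⟨convex_iff_forall_pos.2 ?_, ?_⟩
  · rintro ⟨T, m⟩ ⟨h1, h2⟩ ⟨S, n⟩ ⟨h3, h4⟩ a b ha hb hab
    exact hmem T S a b ha hb h1 h2 h3 h4
  · rintro ⟨T, m⟩ ⟨h1, h2⟩ ⟨S, n⟩ ⟨h3, h4⟩ a b ha hb hab
    have h5 := hmem T S a b ha hb h1 h2 h3 h4
    have hq : ∀ z : Fin d → ℝ, z ⬝ᵥ (A * (a • T + b • S)).mulVec z =
        a * (z ⬝ᵥ (A * T).mulVec z) + b * (z ⬝ᵥ (A * S).mulVec z) := fun z => by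
      simp only [Matrix.mul_add, Matrix.mul_smul, add_mulVec, smul_mulVec, dotProduct_add,
        dotProduct_smul, smul_eq_mul]
    have hl : ∀ z : Fin d → ℝ, (a • m + b • n) ⬝ᵥ A.mulVec z =
        a * (m ⬝ᵥ A.mulVec z) + b * (n ⬝ᵥ A.mulVec z) := fun z => by
      simp only [add_dotProduct, smul_dotProduct, smul_eq_mul]
    have hw := integrable_aux hAdiag h5.1 hApd h5.2 (a • m + b • n)
    have he : ∀ z : Fin d → ℝ, -(1 / 2) * (z ⬝ᵥ (A * (a • T + b • S)).mulVec z) +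
        (a • m + b • n) ⬝ᵥ A.mulVec z =
        a * (-(1 / 2) * (z ⬝ᵥ (A * T).mulVec z) + m ⬝ᵥ A.mulVec z) +
        b * (-(1 / 2) * (z ⬝ᵥ (A * S).mulVec z) + n ⬝ᵥ A.mulVec z) := fun z => by
      rw [hq, hl]; ring
    have e1 : a • (T, m) + b • (S, n) = (a • T + b • S, a • m + b • n) := rfl
    simp only [he] at hw
    have := log_integral_aux ha hb hab (integrable_aux hAdiag h1 hApd h2 m)
      (integrable_aux hAdiag h3 hApd h4 n) hw
    rw [e1, hf, hf, hf]
    dsimp only at this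
    simp only [he]
    rw [hq, hl]
    simp only [smul_eq_mul]
    linarith
end

section
/- Let Σ and Σ* be d×d real diagonal positive definite matrices and let 0 < ε < λ_min(Σ*). If λ > 0 satisfies λ·Σ_{ii} ≠ 1 for every i and Σᵢ Σ*_{ii} / (λ·Σ_{ii} − 1)² = ε, then λ·Σ_{ii} > 1 for every i, i.e. λ·Σ − I is positive definite. Equivalently: for any λ > 0 such that λ·Σ_{kk} < 1 for some index k (and λ·Σ_{ii} ≠ 1 for all i), one has Σᵢ Σ*_{ii} / (λ·Σ_{ii} − 1)² ≥ λ_min(Σ*). -/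
open Matrix

/-- The smallest eigenvalue of a (Hermitian) real matrix. -/
noncomputable def eigMin {d : ℕ} (A : Matrix (Fin d) (Fin d) ℝ) : ℝ :=
  if h : A.IsHermitian then ⨅ i, h.eigenvalues i else 0

theorem eigMin_le_diag_aux {d : ℕ} (A : Matrix (Fin d) (Fin d) ℝ) (hA : A.IsDiag)
    (h : A.IsHermitian) (k : Fin d) : eigMin A ≤ A k k := by
  have hk : A k k ∈ spectrum ℝ A := by
    rw [← hA.diagonal_diag, spectrum_diagonal]
    exact ⟨k, by simp⟩
  rw [h.spectrum_real_eq_range_eigenvalues] at hk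
  obtain ⟨j, hj⟩ := hk
  rw [eigMin, dif_pos h, ← hj]
  exact ciInf_le (Set.finite_range _).bddBelow j

/-- **Small budgets force a PSD adversarial operator.** For diagonal positive definite
`Σ, Σ*` and `0 < ε < λ_min(Σ*)`: if `λ > 0` satisfies `λ·Σᵢᵢ ≠ 1` for all `i` and
`∑ i, Σ*ᵢᵢ / (λ·Σᵢᵢ − 1)² = ε`, then `λ·Σᵢᵢ > 1` for every `i`,
i.e. `λ·Σ − I` is positive definite. -/
theorem small_eps_forces_psd
    {d : ℕ} (hd : 1 ≤ d)
    (S Sstar : Matrix (Fin d) (Fin d) ℝ)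
    (hSdiag : S.IsDiag) (hSpd : S.PosDef)
    (hSstardiag : Sstar.IsDiag) (hSstarpd : Sstar.PosDef)
    (ε : ℝ) (hε : 0 < ε) (hεlt : ε < eigMin Sstar)
    (lam : ℝ) (hlam : 0 < lam) (hne : ∀ i, lam * S i i ≠ 1)
    (hsum : ∑ i, Sstar i i / (lam * S i i - 1) ^ 2 = ε) :
    ∀ i, 1 < lam * S i i := by
  intro k
  by_contra hk
  have hk1 : lam * S k k < 1 := lt_of_le_of_ne (not_lt.mp hk) (hne k)
  have hpos : 0 < lam * S k k := mul_pos hlam hSpd.diag_pos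
  have hmin := eigMin_le_diag_aux Sstar hSstardiag hSstarpd.isHermitian k
  have hterm : Sstar k k / (lam * S k k - 1) ^ 2 ≤ ε := by
    rw [← hsum]
    exact Finset.single_le_sum (f := fun i => Sstar i i / (lam * S i i - 1) ^ 2)
      (fun i _ => div_nonneg hSstarpd.diag_pos.le (sq_nonneg _)) (Finset.mem_univ k)
  have hsq : 0 < (lam * S k k - 1) ^ 2 := by
    have : lam * S k k - 1 ≠ 0 := by linarith
    positivity
  have hsq1 : (lam * S k k - 1) ^ 2 ≤ 1 := by nlinarith
  have hge : Sstar k k ≤ Sstar k k / (lam * S k k - 1) ^ 2 :=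
    le_div_self hSstarpd.diag_pos.le hsq hsq1
  linarith
end

section
/- Let Σ and Σ* be d×d real diagonal positive definite matrices and let λ > 0 be such that λ·Σ − I is positive definite. Set M = (λ·Σ − I)^{-1} and ε = tr(Σ*·M²). Then ε > 0 and λ ≥ (d / tr(Σ)) · (1 + √(d·λ_min(Σ*) / ε)). -/
open Matrix

theorem eigMin_le_diagonal {d : ℕ} (t : Fin d → ℝ) (i : Fin d) :
    eigMin (diagonal t) ≤ t i := by
  have h : (diagonal t).IsHermitian := by
    simp [Matrix.IsHermitian]
  have hm : t i ∈ Set.range h.eigenvalues := by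
    rw [← h.spectrum_real_eq_range_eigenvalues, spectrum_diagonal]
    exact ⟨i, rfl⟩
  obtain ⟨j, hj⟩ := hm
  rw [eigMin, dif_pos h, ← hj]
  exact ciInf_le (Set.finite_range _).bddBelow j

theorem tangent_bound (a A : ℝ) (ha : 0 < a) (hA : 0 < A) :
    3 / A ^ 2 - 2 * a / A ^ 3 ≤ (a ^ 2)⁻¹ := by
  have : (a ^ 2)⁻¹ - (3 / A ^ 2 - 2 * a / A ^ 3)
      = (a - A) ^ 2 * (2 * a + A) / (a ^ 2 * A ^ 3) := by
    field_simp
    ring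
  have h2 : 0 ≤ (a - A) ^ 2 * (2 * a + A) / (a ^ 2 * A ^ 3) := by positivity
  linarith

/-- **Lower bound on the Lagrange multiplier.** For diagonal positive definite `Σ, Σ*`
and `λ > 0` with `λ·Σ − I` positive definite, setting `M = (λ·Σ − I)⁻¹` and
`ε = tr(Σ*·M²)`, one has `ε > 0` and `λ ≥ (d / tr(Σ)) · (1 + √(d·λ_min(Σ*) / ε))`. -/
theorem lagrange_multiplier_lower_bound
    {d : ℕ} (hd : 1 ≤ d)
    (S Sstar : Matrix (Fin d) (Fin d) ℝ)
    (hSdiag : S.IsDiag) (hSpd : S.PosDef)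
    (hSstardiag : Sstar.IsDiag) (hSstarpd : Sstar.PosDef)
    (lam : ℝ) (hlam : 0 < lam) (hpd : (lam • S - 1).PosDef)
    (M : Matrix (Fin d) (Fin d) ℝ) (hM : M = (lam • S - 1)⁻¹)
    (ε : ℝ) (hε : ε = Matrix.trace (Sstar * M ^ 2)) :
    0 < ε ∧
    ((d : ℝ) / Matrix.trace S) * (1 + Real.sqrt (d * eigMin Sstar / ε)) ≤ lam := by
  obtain ⟨s, rfl⟩ : ∃ s, S = diagonal s := ⟨_, hSdiag.diagonal_diag.symm⟩
  obtain ⟨t, rfl⟩ : ∃ t, Sstar = diagonal t := ⟨_, hSstardiag.diagonal_diag.symm⟩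
  have : NeZero d := ⟨by omega⟩
  have hd' : (0 : ℝ) < d := by exact_mod_cast hd
  have hs : ∀ i, 0 < s i := posDef_diagonal_iff.1 hSpd
  have ht : ∀ i, 0 < t i := posDef_diagonal_iff.1 hSstarpd
  have hdiag : lam • diagonal s - 1 = diagonal (fun i => lam * s i - 1) := by
    ext i j
    by_cases hij : i = j
    · subst hij; simp
    · simp [hij]
  rw [hdiag] at hpd hM
  have ha : ∀ i, 0 < lam * s i - 1 := posDef_diagonal_iff.1 hpd
  have hM' : M = diagonal (fun i => (lam * s i - 1)⁻¹) := by
    rw [hM]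
    apply Matrix.inv_eq_right_inv
    rw [diagonal_mul_diagonal, ← diagonal_one]
    congr 1
    funext i
    exact mul_inv_cancel₀ (ha i).ne'
  have hε' : ε = ∑ i, t i * ((lam * s i - 1) ^ 2)⁻¹ := by
    rw [hε, hM', diagonal_pow, diagonal_mul_diagonal, trace_diagonal]
    simp
  have hpos : 0 < ε := by
    rw [hε']
    exact Finset.sum_pos (fun i _ => mul_pos (ht i) (inv_pos.2 (pow_pos (ha i) 2)))
      Finset.univ_nonempty
  refine ⟨hpos, ?_⟩
  rw [trace_diagonal]
  have hT : 0 < ∑ i, s i := Finset.sum_pos (fun i _ => hs i) Finset.univ_nonempty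
  have hsum : ∑ i, (lam * s i - 1) = lam * ∑ i, s i - d := by
    simp [Finset.sum_sub_distrib, Finset.mul_sum]
  have hsumpos : 0 < ∑ i, (lam * s i - 1) :=
    Finset.sum_pos (fun i _ => ha i) Finset.univ_nonempty
  obtain ⟨A, hA⟩ : ∃ A, A = (∑ i, (lam * s i - 1)) / d := ⟨_, rfl⟩
  have hApos : 0 < A := by rw [hA]; positivity
  have hAs : ∑ i, (lam * s i - 1) = d * A := by rw [hA]; field_simp
  have hB : d / A ^ 2 ≤ ∑ i, ((lam * s i - 1) ^ 2)⁻¹ := by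
    calc d / A ^ 2 = ∑ i, (3 / A ^ 2 - 2 * (lam * s i - 1) / A ^ 3) := by
          rw [Finset.sum_sub_distrib, ← Finset.sum_div, ← Finset.sum_div, ← Finset.mul_sum, hAs]
          simp
          field_simp
          ring
      _ ≤ _ := Finset.sum_le_sum fun i _ => tangent_bound _ _ (ha i) hApos
  have hm0 : 0 ≤ eigMin (diagonal t) := by
    rw [eigMin, dif_pos hSstarpd.isHermitian]
    exact Real.iInf_nonneg fun i => (hSstarpd.eigenvalues_pos i).le
  have hE : eigMin (diagonal t) * (d / A ^ 2) ≤ ε := by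
    calc _ ≤ eigMin (diagonal t) * ∑ i, ((lam * s i - 1) ^ 2)⁻¹ :=
          mul_le_mul_of_nonneg_left hB hm0
      _ ≤ ε := by
          rw [hε', Finset.mul_sum]
          exact Finset.sum_le_sum fun i _ => mul_le_mul_of_nonneg_right
            (eigMin_le_diagonal t i) (inv_nonneg.2 (sq_nonneg _))
  have hsq : Real.sqrt (d * eigMin (diagonal t) / ε) ≤ A := by
    apply Real.sqrt_le_iff.2 ⟨hApos.le, ?_⟩
    rw [div_le_iff₀ hpos]
    have : eigMin (diagonal t) * (d / A ^ 2) * A ^ 2 ≤ ε * A ^ 2 :=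
      mul_le_mul_of_nonneg_right hE (sq_nonneg _)
    have e : eigMin (diagonal t) * (d / A ^ 2) * A ^ 2 = d * eigMin (diagonal t) := by
      field_simp
    linarith
  rw [div_mul_eq_mul_div, div_le_iff₀ hT]
  nlinarith [mul_le_mul_of_nonneg_left hsq hd'.le]
end

section
/- Let Σ and Σ* be d×d real diagonal positive definite matrices and let λ > 0 be such that λ·Σ − I is positive definite. Set M = (λ·Σ − I)^{-1} and ε = tr(Σ*·M²). Then λ ≤ (1 / λ_min(Σ)) · (√(‖Σ*‖_F · d / ε) + 1). -/
open Matrix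

/-- The Frobenius norm of a real matrix. -/
noncomputable def frobNorm {d : ℕ} (A : Matrix (Fin d) (Fin d) ℝ) : ℝ :=
  Real.sqrt (∑ i, ∑ j, (A i j) ^ 2)

lemma eigMin_diag_aux {d : ℕ} (hd : 1 ≤ d) (s : Fin d → ℝ) (h : (diagonal s).PosDef) :
    0 < eigMin (diagonal s) ∧ ∀ i, eigMin (diagonal s) ≤ s i := by
  have : Nonempty (Fin d) := ⟨⟨0, hd⟩⟩
  have hh := h.isHermitian
  have e : eigMin (diagonal s) = ⨅ i, hh.eigenvalues i := by
    unfold eigMin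
    rw [dif_pos hh]
  rw [e]
  constructor
  · obtain ⟨i, hi⟩ := exists_eq_ciInf_of_finite (f := hh.eigenvalues)
    rw [← hi]
    exact h.eigenvalues_pos i
  · intro i
    have h1 : s i ∈ spectrum ℝ (diagonal s) := by
      rw [spectrum_diagonal]
      exact ⟨i, rfl⟩
    rw [hh.spectrum_real_eq_range_eigenvalues] at h1
    obtain ⟨j, hj⟩ := h1
    rw [← hj]
    exact ciInf_le (Set.finite_range _).bddBelow j

/-- **Upper bound on the Lagrange multiplier.** For diagonal positive definite `Σ, Σ*`
and `λ > 0` with `λ·Σ − I` positive definite, setting `M = (λ·Σ − I)⁻¹` and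
`ε = tr(Σ*·M²)`, one has `λ ≤ (1 / λ_min(Σ)) · (√(‖Σ*‖_F·d / ε) + 1)`. -/
theorem lagrange_multiplier_upper_bound
    {d : ℕ} (hd : 1 ≤ d)
    (S Sstar : Matrix (Fin d) (Fin d) ℝ)
    (hSdiag : S.IsDiag) (hSpd : S.PosDef)
    (hSstardiag : Sstar.IsDiag) (hSstarpd : Sstar.PosDef)
    (lam : ℝ) (hlam : 0 < lam) (hpd : (lam • S - 1).PosDef)
    (M : Matrix (Fin d) (Fin d) ℝ) (hM : M = (lam • S - 1)⁻¹)
    (ε : ℝ) (hε : ε = Matrix.trace (Sstar * M ^ 2)) :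
    lam ≤ (1 / eigMin S) * (Real.sqrt (frobNorm Sstar * d / ε) + 1) := by
  obtain ⟨s, rfl⟩ : ∃ s, S = diagonal s := ⟨_, hSdiag.diagonal_diag.symm⟩
  obtain ⟨t, rfl⟩ : ∃ t, Sstar = diagonal t := ⟨_, hSstardiag.diagonal_diag.symm⟩
  obtain ⟨hm, hms⟩ := eigMin_diag_aux hd s hSpd
  set m := eigMin (diagonal s)
  have ht : ∀ i, 0 < t i := fun i => by simpa using hSstarpd.diag_pos (i := i)
  have hp : ∀ i, 0 < lam * s i - 1 := fun i => by simpa using hpd.diag_pos (i := i)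
  have hMd : M = diagonal (fun i => (lam * s i - 1)⁻¹) := by
    rw [hM]
    apply Matrix.inv_eq_right_inv
    rw [← diagonal_one, ← diagonal_smul, diagonal_sub, diagonal_mul_diagonal]
    congr 1
    funext i
    exact mul_inv_cancel₀ (hp i).ne'
  have hε' : ε = ∑ i, t i * ((lam * s i - 1)⁻¹) ^ 2 := by
    rw [hε, hMd, diagonal_pow, diagonal_mul_diagonal, trace_diagonal]
    rfl
  have hne : (Finset.univ : Finset (Fin d)).Nonempty := ⟨⟨0, hd⟩, Finset.mem_univ _⟩
  have hεpos : 0 < ε := by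
    rw [hε']
    exact Finset.sum_pos (fun i _ => mul_pos (ht i) (pow_pos (inv_pos.2 (hp i)) 2)) hne
  have hF : ∀ i, t i ≤ frobNorm (diagonal t) := by
    intro i
    apply Real.le_sqrt_of_sq_le
    calc t i ^ 2 = (diagonal t i i) ^ 2 := by simp
      _ ≤ ∑ j, (diagonal t i j) ^ 2 :=
        Finset.single_le_sum (f := fun j => (diagonal t i j) ^ 2)
          (fun j _ => sq_nonneg _) (Finset.mem_univ i)
      _ ≤ _ := Finset.single_le_sum (f := fun i => ∑ j, (diagonal t i j) ^ 2)
          (fun i _ => Finset.sum_nonneg (fun j _ => sq_nonneg _)) (Finset.mem_univ i)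
  suffices h : lam * m - 1 ≤ Real.sqrt (frobNorm (diagonal t) * d / ε) by
    rw [one_div, inv_mul_eq_div, le_div_iff₀ hm]
    linarith
  rcases le_or_gt (lam * m - 1) 0 with h0 | h0
  · exact h0.trans (Real.sqrt_nonneg _)
  apply Real.le_sqrt_of_sq_le
  rw [le_div_iff₀ hεpos, hε', Finset.mul_sum]
  calc _ ≤ ∑ i : Fin d, frobNorm (diagonal t) := by
        apply Finset.sum_le_sum
        intro i _
        refine le_trans ?_ (hF i)
        have h1 : lam * m - 1 ≤ lam * s i - 1 := by
          have := mul_le_mul_of_nonneg_left (hms i) hlam.le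
          linarith
        have h2 : (lam * m - 1) ^ 2 ≤ (lam * s i - 1) ^ 2 := pow_le_pow_left₀ h0.le h1 2
        rw [inv_pow, ← div_eq_mul_inv, ← mul_div_assoc, div_le_iff₀ (pow_pos (hp i) 2), mul_comm]
        exact mul_le_mul_of_nonneg_left h2 (ht i).le
    _ = _ := by simp [mul_comm]
end
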